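/- Let A be a finite alphabet with exactly 3 letters, let (c_n)_{n≥0} be a directive sequence over A (every letter of A occurs infinitely often in (c_n)), let a ∈ A, and let x be the associated Arnoux–Rauzy word x = lim_{n→∞} σ_{c_0} ∘ σ_{c_1} ∘ ⋯ ∘ σ_{c_n}(a). Then x is uniformly factor-balanced if and only if there exists C ∈ ℕ such that (c_n) contains no C+1 consecutive equal letters (i.e., the weak partial quotients of the directive sequence are bounded). -/

import Mathlib

open scoped Classical

section Core

variable {A : Type*} {B : Type*}

/-- `w` occurs at position `i` of the infinite word `x`. -/
def OccursAt (x : ℕ → A) (w : List A) (i : ℕ) : Prop :=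
  w = (List.range w.length).map fun j => x (i + j)

/-- `w` is a factor of the infinite word `x`. -/
def IsFactor (x : ℕ → A) (w : List A) : Prop := ∃ i, OccursAt x w i

/-- The number of (possibly overlapping) occurrences of `w` in the finite word `u`,
i.e. `|u|_w`. -/
noncomputable def countOccs (u w : List A) : ℕ :=
  ((Finset.range (u.length + 1)).filter fun i => w <+: u.drop i).card

/-- The finite word `w` is `C`-balanced in the infinite word `x`. -/
def BalancedIn (C : ℝ) (w : List A) (x : ℕ → A) : Prop :=
  ∀ u v : List A, IsFactor x u → IsFactor x v → u.length = v.length →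
    |(countOccs u w : ℝ) - (countOccs v w : ℝ)| ≤ C

/-- Every finite word is `C_w`-balanced in `x` for some constant `C_w > 0`. -/
def FactorBalanced (x : ℕ → A) : Prop :=
  ∀ w : List A, ∃ C : ℝ, 0 < C ∧ BalancedIn C w x

/-- There is a single constant `C > 0` such that every finite word is `C`-balanced in `x`. -/
def UniformlyFactorBalanced (x : ℕ → A) : Prop :=
  ∃ C : ℝ, 0 < C ∧ ∀ w : List A, BalancedIn C w x

/-- Every letter is `C`-balanced in `x`. -/
def LetterBalanced (C : ℝ) (x : ℕ → A) : Prop :=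
  ∀ a : A, BalancedIn C [a] x

/-- `x` is `P`-power-free: no factor of `x` is a `P`-th power of a nonempty word. -/
def PowerFree (P : ℕ) (x : ℕ → A) : Prop :=
  ∀ v : List A, v ≠ [] → ¬ IsFactor x (List.flatten (List.replicate P v))

/-- The length-`n` prefix of the infinite word `x`. -/
def wordPrefix (x : ℕ → A) (n : ℕ) : List A := (List.range n).map x

/-- The extension of a substitution to finite words. -/
def substWord (τ : A → List B) (w : List A) : List B := (w.map τ).flatten

/-- The word `w` has (prefix) frequency `μ` in `x`. -/
def HasFreq (x : ℕ → A) (w : List A) (μ : ℝ) : Prop :=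
  Filter.Tendsto (fun n => (countOccs (wordPrefix x n) w : ℝ) / n)
    Filter.atTop (nhds μ)

/-- `τ` is `k`-decisive in `x` with witness map `r` (each `r a` of length `k ≥ 1`,
and `τ b` starts with `r a` whenever `ab` is a factor of `x`). -/
def DecisiveWith (τ : A → List B) (x : ℕ → A) (r : A → List B) (k : ℕ) : Prop :=
  1 ≤ k ∧ (∀ a, (r a).length = k) ∧
    ∀ a b : A, IsFactor x [a, b] → r a <+: τ b

/-- `τ` is `k`-decisive in `x`. -/
def Decisive (τ : A → List B) (x : ℕ → A) (k : ℕ) : Prop :=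
  ∃ r : A → List B, DecisiveWith τ x r k

/-- The image of the infinite word `x` under the substitution `τ`: when the images of
prefixes of `x` have unbounded length, `substInf τ x` is the infinite word `τ(x)`. -/
noncomputable def substInf [Nonempty B] (τ : A → List B) (x : ℕ → A) (j : ℕ) : B :=
  if h : ∃ n, j < (substWord τ (wordPrefix x n)).length
  then (substWord τ (wordPrefix x (Nat.find h))).get ⟨j, Nat.find_spec h⟩
  else Classical.arbitrary B

/-- Iterates of a substitution: `substIter τ n a = τ^n(a)` as a finite word. -/
def substIter (τ : A → List A) : ℕ → A → List A
  | 0, a => [a]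
  | n+1, a => substWord (substIter τ n) (τ a)

/-- `τ` is prolongable on the letter `a`. -/
def Prolongable (τ : A → List A) (a : A) : Prop :=
  (τ a).head? = some a ∧ (∀ b, τ b ≠ []) ∧
    Filter.Tendsto (fun n => (substIter τ n a).length) Filter.atTop Filter.atTop

/-- The fixed point `τ^ω(a)` of a substitution prolongable on `a`:
the limit of the prefix chain `τ^n(a)`. -/
noncomputable def fixedPoint (τ : A → List A) (a : A) (j : ℕ) : A :=
  if h : ∃ n, j < (substIter τ n a).length
  then (substIter τ (Nat.find h) a).get ⟨j, Nat.find_spec h⟩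
  else a

/-- The factor complexity of `x`: the number of distinct length-`n` factors. -/
noncomputable def complexity (x : ℕ → A) (n : ℕ) : ℕ :=
  Set.ncard {w : List A | w.length = n ∧ IsFactor x w}

/-- Every factor of `x` occurs infinitely often in `x`. -/
def Recurrent (x : ℕ → A) : Prop :=
  ∀ w : List A, IsFactor x w → ∀ N : ℕ, ∃ i, N ≤ i ∧ OccursAt x w i

/-- For every factor `w` of `x` there is `k` such that `w` occurs in
every length-`k` factor of `x`. -/
def UniformlyRecurrent (x : ℕ → A) : Prop :=
  ∀ w : List A, IsFactor x w → ∃ k : ℕ, ∀ v : List A, IsFactor x v →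
    v.length = k → 1 ≤ countOccs v w

end Core

section ArnouxRauzy

variable {A : Type*}

/-- The Arnoux–Rauzy substitution `σ_a`: it maps `a` to `a` and any `b ≠ a` to `ba`. -/
def arSubst [DecidableEq A] (a b : A) : List A := if b = a then [a] else [b, a]

/-- `arIter c n = σ_{c 0} ∘ σ_{c 1} ∘ ⋯ ∘ σ_{c (n-1)}` (identity for `n = 0`). -/
def arIter [DecidableEq A] (c : ℕ → A) : ℕ → A → List A
  | 0, b => [b]
  | n+1, b => substWord (arIter c n) (arSubst (c n) b)

/-- The Arnoux–Rauzy word associated with the directive sequence `c` and letter `a`: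
the limit of the prefix chain `σ_{c 0} ∘ ⋯ ∘ σ_{c n}(a)`. -/
noncomputable def arLimit [DecidableEq A] (c : ℕ → A) (a : A) (j : ℕ) : A :=
  if h : ∃ n, j < (arIter c n a).length
  then (arIter c (Nat.find h) a).get ⟨j, Nat.find_spec h⟩
  else a

end ArnouxRauzy

/-! ### Arnoux–Rauzy words as images of Arnoux–Rauzy words -/

section Desubstitution

variable {A : Type*}

lemma substWord_append {B : Type*} (τ : A → List B) (u v : List A) :
    substWord τ (u ++ v) = substWord τ u ++ substWord τ v := by
  simp [substWord]

lemma substWord_comp {B D : Type*} (τ : B → List D) (ρ : A → List B) (w : List A) :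
    substWord (fun e => substWord τ (ρ e)) w = substWord τ (substWord ρ w) := by
  induction w with
  | nil => rfl
  | cons e w ih =>
    have h (w' : List A) : e :: w' = [e] ++ w' := rfl
    rw [h, substWord_append, substWord_append, substWord_append, ih]
    simp [substWord]

variable [DecidableEq A]

/-- The position in `σ_a(y)` of the image of the letter of `y` at position `k`. -/
def blockPos (a : A) (y : ℕ → A) : ℕ → ℕ
  | 0 => 0
  | k + 1 => blockPos a y k + if y k = a then 1 else 2

/-- The infinite word `x` is the image `σ_a(y)`, described position by position. -/
def IsArImage (a : A) (x y : ℕ → A) : Prop :=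
  ∀ k, x (blockPos a y k) = y k ∧ (y k ≠ a → x (blockPos a y k + 1) = a)

lemma arIter_succ_outer (c : ℕ → A) (n : ℕ) (b : A) :
    arIter c (n + 1) b =
      substWord (arSubst (c 0)) (arIter (fun i => c (i + 1)) n b) := by
  induction n generalizing b with
  | zero =>
    have h (w : List A) : substWord (fun e => [e]) w = w := by
      induction w with
      | nil => rfl
      | cons e w ih => simpa [substWord] using ih
    exact (h _).trans (by simp [substWord, arIter])
  | succ n ih =>
    rw [arIter]
    simp only [funext ih, substWord_comp]
    rfl

lemma arIter_prefix_succ (c : ℕ → A) (a : A) (n : ℕ) :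
    arIter c n a <+: arIter c (n + 1) a := by
  rw [arIter, arSubst]
  split_ifs with h
  · simp [substWord, h]
  · simp [substWord]

lemma arIter_prefix (c : ℕ → A) (a : A) {m n : ℕ} (h : m ≤ n) :
    arIter c m a <+: arIter c n a := by
  induction n, h using Nat.le_induction with
  | base => exact List.prefix_rfl
  | succ n _ ih => exact ih.trans (arIter_prefix_succ c a n)

lemma arIter_ne_nil (c : ℕ → A) (a : A) (n : ℕ) : arIter c n a ≠ [] := by
  intro h
  have := (arIter_prefix c a (Nat.zero_le n)).length_le
  simp [h, arIter] at this

lemma exists_le_length_arIter {c : ℕ → A} {a : A} (hc : ∀ N, ∃ n, N ≤ n ∧ c n ≠ a)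
    (L : ℕ) : ∃ n, L ≤ (arIter c n a).length := by
  induction L with
  | zero => exact ⟨0, Nat.zero_le _⟩
  | succ L ih =>
    obtain ⟨n, hn⟩ := ih
    obtain ⟨n', h', hne⟩ := hc n
    refine ⟨n' + 1, ?_⟩
    have h1 := (arIter_prefix c a h').length_le
    have h2 := List.length_pos_iff.2 (arIter_ne_nil c (c n') n')
    rw [arIter, arSubst, if_neg (Ne.symm hne)]
    simp only [substWord, List.map_cons, List.map_nil, List.flatten_cons, List.flatten_nil,
      List.append_nil, List.length_append]
    omega

lemma arLimit_eq_getElem (c : ℕ → A) (a : A) {n j : ℕ} (h : j < (arIter c n a).length) :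
    arLimit c a j = (arIter c n a)[j] := by
  have hex : ∃ n, j < (arIter c n a).length := ⟨n, h⟩
  rw [arLimit, dif_pos hex, List.get_eq_getElem]
  exact (arIter_prefix c a (Nat.find_min' hex h)).getElem _

lemma isArImage_of_prefix {a : A} {x y : ℕ → A}
    (h : ∀ K, ∀ j (hj : j < (substWord (arSubst a) (wordPrefix y K)).length),
      x j = (substWord (arSubst a) (wordPrefix y K))[j]) : IsArImage a x y := by
  have hsucc (k : ℕ) : substWord (arSubst a) (wordPrefix y (k + 1)) =
      substWord (arSubst a) (wordPrefix y k) ++ arSubst a (y k) := by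
    simp [wordPrefix, List.range_succ, substWord]
  have hlen (k : ℕ) : (substWord (arSubst a) (wordPrefix y k)).length = blockPos a y k := by
    induction k with
    | zero => rfl
    | succ k ih =>
      rw [hsucc, List.length_append, ih, blockPos, arSubst]
      split_ifs <;> rfl
  intro k
  have hk := h (k + 1)
  simp only [hsucc, List.length_append, hlen] at hk
  constructor
  · rw [hk _ (by unfold arSubst; split_ifs <;> simp), List.getElem_append_right (hlen k).le]
    simp only [hlen, arSubst, Nat.sub_self]
    split_ifs with h1 <;> simp [h1]
  · intro hne
    rw [hk _ (by simp [arSubst, hne]), List.getElem_append_right (by rw [hlen]; omega)]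
    simp [hlen, arSubst, hne]

lemma isArImage_arLimit {c : ℕ → A} {a : A} (hc : ∀ N, ∃ n, N ≤ n ∧ c n ≠ a) :
    IsArImage (c 0) (arLimit c a) (arLimit (fun i => c (i + 1)) a) := by
  apply isArImage_of_prefix
  intro K j hj
  have hc' : ∀ N, ∃ n, N ≤ n ∧ (fun i => c (i + 1)) n ≠ a := by
    intro N
    obtain ⟨n, hn, hne⟩ := hc (N + 1)
    exact ⟨n - 1, by omega, by simpa [Nat.sub_add_cancel (by omega : 1 ≤ n)] using hne⟩
  obtain ⟨n, hn⟩ := exists_le_length_arIter hc' K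
  have hpre : wordPrefix (arLimit (fun i => c (i + 1)) a) K <+:
      arIter (fun i => c (i + 1)) n a := by
    rw [List.prefix_iff_getElem]
    refine ⟨by simpa [wordPrefix] using hn, fun i hi => ?_⟩
    have hi' : i < K := by simpa [wordPrefix] using hi
    simp only [wordPrefix, List.getElem_map, List.getElem_range]
    exact arLimit_eq_getElem _ _ (by omega)
  have hpre' : substWord (arSubst (c 0)) (wordPrefix (arLimit (fun i => c (i + 1)) a) K) <+:
      arIter c (n + 1) a := by
    obtain ⟨t, ht⟩ := hpre
    rw [arIter_succ_outer, ← ht, substWord_append]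
    exact List.prefix_append _ _
  rw [arLimit_eq_getElem c a (hj.trans_le hpre'.length_le)]
  exact (hpre'.getElem hj).symm

lemma arLimit_zero (c : ℕ → A) (a : A) : arLimit c a 0 = a := by
  rw [arLimit_eq_getElem c a (n := 0) (by simp [arIter])]
  simp [arIter]

end Desubstitution

/-! ### Imbalance vectors along the desubstitution -/

section Imbalance

variable {A : Type*}

/-- One letter of the vector `d` is far below zero, and the two others are nonnegative, one of
them being large. -/
def HasLoneLetter (m : ℤ) (d : A → ℤ) : Prop :=
  ∃ a b g : A, a ≠ b ∧ a ≠ g ∧ b ≠ g ∧ d a ≤ -(m + 2) ∧ 0 ≤ d b ∧ m ≤ d g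

/-- The vector `d` has two large coordinates of opposite signs, and a small one at the letter `b`
which has been constant in the directive sequence on `[s, n)`. -/
def IsTransitional (c : ℕ → A) (m : ℤ) (n : ℕ) (d : A → ℤ) : Prop :=
  ∃ a b g : A, a ≠ b ∧ a ≠ g ∧ b ≠ g ∧ d a ≤ -m ∧ m ≤ d g ∧
    ∃ s < n, (∀ i, s ≤ i → i < n → c i = b) ∧ |d b| ≤ 4 * ((n : ℤ) - s)

/-- The vector `d` has a negative coordinate that dominates a large positive one, while the third
coordinate is small and nonpositive. -/
def IsDominated (t m : ℤ) (d : A → ℤ) : Prop :=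
  ∃ a b g : A, a ≠ b ∧ a ≠ g ∧ b ≠ g ∧ m ≤ d g ∧ -t ≤ d b ∧ d b ≤ 0 ∧ d a ≤ -(d g + t + 4)

/-- The vector `d` at level `n` is too imbalanced to become small at a later level. -/
def IsImbalanced (c : ℕ → A) (C n : ℕ) (d : A → ℤ) : Prop :=
  HasLoneLetter (8 * C + 6) d ∨ IsTransitional c (8 * C + 6) n d ∨
    IsDominated (4 * C) (8 * C + 6) d

lemma IsImbalanced.exists_ge {c : ℕ → A} {C n : ℕ} {d : A → ℤ} (h : IsImbalanced c C n d) :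
    ∃ g, 8 * (C : ℤ) + 6 ≤ d g := by
  obtain ⟨a, b, g, -, -, -, -, -, h⟩ | ⟨a, b, g, -, -, -, -, h, -⟩ | ⟨a, b, g, -, -, -, h, -⟩ := h
  all_goals exact ⟨g, h⟩

section Triple

variable [Fintype A]

lemma eq_or_eq_or_eq_of_card_eq_three (hA : Fintype.card A = 3) {a b g : A} (hab : a ≠ b)
    (hag : a ≠ g) (hbg : b ≠ g) (e : A) : e = a ∨ e = b ∨ e = g := by
  classical
  have h : ({a, b, g} : Finset A) = Finset.univ :=
    Finset.eq_univ_of_card _ (by rw [hA, Finset.card_eq_three]; exact ⟨a, b, g, hab, hag, hbg, rfl⟩)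
  have he := Finset.mem_univ e
  rw [← h] at he
  simpa using he

lemma sum_eq_of_card_eq_three (hA : Fintype.card A = 3) {a b g : A} (hab : a ≠ b)
    (hag : a ≠ g) (hbg : b ≠ g) (d : A → ℤ) : ∑ e, d e = d a + d b + d g := by
  classical
  have h : ({a, b, g} : Finset A) = Finset.univ :=
    Finset.eq_univ_of_card _ (by rw [hA, Finset.card_eq_three]; exact ⟨a, b, g, hab, hag, hbg, rfl⟩)
  rw [← h, Finset.sum_insert (by simp [hab, hag]), Finset.sum_pair hbg, add_assoc]

/-- Being sum-free and having a large coordinate entails imbalance. -/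
lemma isImbalanced_of_sum_eq_zero (hA : Fintype.card A = 3) {c : ℕ → A} {C n : ℕ} {d : A → ℤ}
    (hd : ∑ e, d e = 0) {a : A} (ha : d a ≤ -(16 * C + 14)) :
    IsImbalanced c C n d ∨ IsImbalanced c C n (-d) := by
  classical
  obtain ⟨b, hb⟩ := Fintype.exists_ne_of_one_lt_card (by omega : 1 < Fintype.card A) a
  obtain ⟨g, hg⟩ : ∃ g, g ∉ ({a, b} : Finset A) := by
    by_contra! h
    have := Finset.card_le_card (fun e _ => h e : (Finset.univ : Finset A) ⊆ {a, b})
    rw [Finset.card_univ, hA] at this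
    exact absurd (this.trans Finset.card_le_two) (by norm_num)
  simp only [Finset.mem_insert, Finset.mem_singleton, not_or] at hg
  rw [sum_eq_of_card_eq_three hA hb.symm (Ne.symm hg.1) (Ne.symm hg.2)] at hd
  wlog hbg : d b ≤ d g generalizing b g
  · exact this g hg.1 b (by omega) ⟨hb, Ne.symm hg.2⟩ (by omega)
  by_cases h0 : 0 ≤ d b
  · exact Or.inl <| Or.inl ⟨a, b, g, hb.symm, Ne.symm hg.1, Ne.symm hg.2, by omega, h0, by omega⟩
  · refine Or.inr <| Or.inl ⟨g, b, a, hg.2, hg.1, hb, ?_, ?_, ?_⟩ <;> simp only [Pi.neg_apply] <;>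
      omega

/-- If `c` has no `C + 1` consecutive equal letters, imbalance persists at the next level. -/
lemma IsImbalanced.succ (hA : Fintype.card A = 3) {c : ℕ → A} {C : ℕ}
    (hC : ∀ n, ¬ ∀ j ≤ C, c (n + j) = c n) {n : ℕ} {d d' : A → ℤ}
    (hne : ∀ e ≠ c n, d' e = d e) (heq : |d (c n) - ∑ e, d' e| ≤ 2)
    (h : IsImbalanced c C n d) :
    IsImbalanced c C (n + 1) d' ∨ IsImbalanced c C (n + 1) (-d') := by
  rw [abs_le] at heq
  obtain ⟨a, b, g, hab, hag, hbg, ha, hb, hg⟩ | ⟨a, b, g, hab, hag, hbg, ha, hg, s, hs, hrun, hb⟩ |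
    ⟨a, b, g, hab, hag, hbg, hg, hb, hb0, ha⟩ := h
  · rw [sum_eq_of_card_eq_three hA hab hag hbg] at heq
    obtain h | h | h := eq_or_eq_or_eq_of_card_eq_three hA hab hag hbg (c n) <;> rw [h] at hne heq
    · rw [hne b hab.symm, hne g hag.symm] at heq
      refine .inl <| .inl ⟨a, b, g, hab, hag, hbg, ?_, ?_, ?_⟩
      · omega
      · rwa [hne b hab.symm]
      · rwa [hne g hag.symm]
    · have ea := hne a hab
      have eg := hne g hbg.symm
      by_cases h0 : 0 ≤ d' b
      · exact .inl <| .inl ⟨a, b, g, hab, hag, hbg, by omega, h0, by omega⟩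
      · by_cases hg' : 8 * (C : ℤ) + 8 ≤ d g
        · refine .inr <| .inl ⟨g, b, a, hbg.symm, hag.symm, hab.symm, ?_, ?_, ?_⟩ <;>
            rw [Pi.neg_apply] <;> omega
        · refine .inl <| .inr <| .inl ⟨a, b, g, hab, hag, hbg, by omega, by omega, n,
            Nat.lt_succ_self n, fun i h1 h2 => ?_, ?_⟩
          · rwa [show i = n by omega]
          · rw [abs_le]
            push_cast
            omega
    · have ea := hne a hag
      have eb := hne b hbg
      by_cases h0 : 0 ≤ d' g
      · by_cases hb' : 8 * (C : ℤ) + 6 ≤ d b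
        · exact .inl <| .inl ⟨a, g, b, hag, hab, hbg.symm, by omega, h0, by omega⟩
        · exact .inl <| .inl ⟨a, b, g, hab, hag, hbg, by omega, by omega, by omega⟩
      · refine .inr <| .inl ⟨b, g, a, hbg, hab.symm, hag.symm, ?_, ?_, ?_⟩ <;>
          rw [Pi.neg_apply] <;> omega
  · rw [sum_eq_of_card_eq_three hA hab hag hbg] at heq
    have hsn : n ≤ s + C := by
      by_contra! hlt
      exact hC s fun j hj => by rw [hrun _ (by omega) (by omega), hrun _ le_rfl hs]
    rw [abs_le] at hb
    obtain h | h | h := eq_or_eq_or_eq_of_card_eq_three hA hab hag hbg (c n) <;> rw [h] at hne heq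
    · have eb := hne b hab.symm
      have eg := hne g hag.symm
      by_cases h0 : 0 ≤ d b
      · exact .inl <| .inl ⟨a, b, g, hab, hag, hbg, by omega, by omega, by omega⟩
      · exact .inl <| .inr <| .inr ⟨a, b, g, hab, hag, hbg, by omega, by omega, by omega, by omega⟩
    · have ea := hne a hab
      have eg := hne g hbg.symm
      by_cases hb' : |d' b| ≤ 4 * (((n + 1 : ℕ) : ℤ) - s)
      · refine .inl <| .inr <| .inl ⟨a, b, g, hab, hag, hbg, by omega, by omega, s,
          by omega, fun i h1 h2 => ?_, hb'⟩
        obtain h3 | rfl := Nat.lt_succ_iff_lt_or_eq.1 h2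
        · exact hrun i h1 h3
        · exact h
      · rw [not_le, lt_abs] at hb'
        push_cast at hb'
        obtain hb' | hb' := hb'
        · exact .inl <| .inl ⟨a, b, g, hab, hag, hbg, by omega, by omega, by omega⟩
        · refine .inr <| .inl ⟨g, b, a, hbg.symm, hag.symm, hab.symm, ?_, ?_, ?_⟩ <;>
            rw [Pi.neg_apply] <;> omega
    · have ea := hne a hag
      have eb := hne b hbg
      by_cases h0 : d b ≤ 0
      · refine .inr <| .inl ⟨g, b, a, hbg.symm, hag.symm, hab.symm, ?_, ?_, ?_⟩ <;>
          rw [Pi.neg_apply] <;> omega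
      · refine .inr <| .inr <| .inr ⟨g, b, a, hbg.symm, hag.symm, hab.symm, ?_, ?_, ?_, ?_⟩ <;>
          simp only [Pi.neg_apply] <;> omega
  · rw [sum_eq_of_card_eq_three hA hab hag hbg] at heq
    obtain h | h | h := eq_or_eq_or_eq_of_card_eq_three hA hab hag hbg (c n) <;> rw [h] at hne heq
    · have eb := hne b hab.symm
      have eg := hne g hag.symm
      exact .inl <| .inr <| .inr ⟨a, b, g, hab, hag, hbg, by omega, by omega, by omega, by omega⟩
    · have ea := hne a hab
      have eg := hne g hbg.symm
      exact .inl <| .inl ⟨a, b, g, hab, hag, hbg, by omega, by omega, by omega⟩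
    · have ea := hne a hag
      have eb := hne b hbg
      refine .inr <| .inl ⟨g, b, a, hbg.symm, hag.symm, hab.symm, ?_, ?_, ?_⟩ <;>
        rw [Pi.neg_apply] <;> omega

end Triple

end Imbalance

/-! ### Balance of letters -/

section Blocks

variable {A : Type*} [DecidableEq A] {a : A} {x y : ℕ → A}

lemma blockPos_strictMono (a : A) (y : ℕ → A) : StrictMono (blockPos a y) :=
  strictMono_nat_of_lt_succ fun k => by rw [blockPos]; split_ifs <;> omega

lemma exists_eq_blockPos (a : A) (y : ℕ → A) (i : ℕ) :
    ∃ k, i = blockPos a y k ∨ i = blockPos a y k + 1 ∧ y k ≠ a := by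
  induction i with
  | zero => exact ⟨0, Or.inl rfl⟩
  | succ i ih =>
    obtain ⟨k, rfl | ⟨rfl, hk⟩⟩ := ih
    · by_cases hk : y k = a
      · exact ⟨k + 1, Or.inl (by rw [blockPos, if_pos hk])⟩
      · exact ⟨k, Or.inr ⟨rfl, hk⟩⟩
    · exact ⟨k + 1, Or.inl (by rw [blockPos, if_neg hk])⟩

lemma IsArImage.exists_succ_eq_iff (h : IsArImage a x y) (i : ℕ) :
    (∃ k, i + 1 = blockPos a y k) ↔ x i = a := by
  constructor
  · rintro ⟨_ | k, hk⟩
    · simp [blockPos] at hk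
    · rw [blockPos] at hk
      split_ifs at hk with hy
      · rw [← hy, ← (h k).1]; congr 1; omega
      · rw [← (h k).2 hy]; congr 1; omega
  · intro hi
    obtain ⟨k, rfl | ⟨rfl, hk⟩⟩ := exists_eq_blockPos a y i
    · rw [(h k).1] at hi
      exact ⟨k + 1, by rw [blockPos, if_pos hi]⟩
    · exact ⟨k + 1, by rw [blockPos, if_neg hk]⟩

lemma IsArImage.exists_eq_of_ne (h : IsArImage a x y) {i : ℕ} (hi : x i ≠ a) :
    ∃ k, i = blockPos a y k := by
  obtain ⟨k, rfl | ⟨rfl, hk⟩⟩ := exists_eq_blockPos a y i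
  · exact ⟨k, rfl⟩
  · exact absurd ((h k).2 hk) hi

/-- The number of occurrences of the letter `b` among the first `j` letters of `x`. -/
def letterCount (x : ℕ → A) (b : A) (j : ℕ) : ℕ := Nat.count (fun i => x i = b) j

lemma letterCount_succ (x : ℕ → A) (b : A) (j : ℕ) :
    letterCount x b (j + 1) = letterCount x b j + if x j = b then 1 else 0 :=
  Nat.count_succ _ _

lemma sum_letterCount [Fintype A] (x : ℕ → A) (j : ℕ) : ∑ b, letterCount x b j = j := by
  induction j with
  | zero => simp [letterCount]
  | succ j ih => simp [letterCount_succ, Finset.sum_add_distrib, ih]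

lemma IsArImage.letterCount_blockPos (h : IsArImage a x y) (b : A) (k : ℕ) :
    letterCount x b (blockPos a y k) = if b = a then k else letterCount y b k := by
  induction k with
  | zero => simp [blockPos, letterCount]
  | succ k ih =>
    by_cases hk : y k = a
    · rw [blockPos, if_pos hk, letterCount_succ, ih, (h k).1, letterCount_succ, hk]
      by_cases hb : b = a
      · simp [hb]
      · simp [hb, Ne.symm hb]
    · rw [blockPos, if_neg hk, ← one_add_one_eq_two, ← add_assoc, letterCount_succ,
        letterCount_succ, ih, (h k).1, (h k).2 hk, letterCount_succ]
      by_cases hb : b = a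
      · simp [hb, hk]
      · simp [hb, Ne.symm hb]

/-- Rounding up a position of `x = σ_a(y)` to the next block boundary. -/
lemma IsArImage.exists_roundUp [Fintype A] (h : IsArImage a x y) (j : ℕ) :
    ∃ k ≤ j, (2 ≤ j → y 0 ≠ a → k < j) ∧ (∀ b ≠ a, letterCount x b j = letterCount y b k) ∧
      letterCount x a j ≤ ∑ b, letterCount y b k ∧
      ∑ b, letterCount y b k ≤ letterCount x a j + 1 := by
  simp only [sum_letterCount]
  have hlow (k : ℕ) (hk : 1 ≤ k) (h0 : y 0 ≠ a) : k + 1 ≤ blockPos a y k := by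
    induction k, hk using Nat.le_induction with
    | base => simp [blockPos, h0]
    | succ k _ ih => exact ih.trans_lt (blockPos_strictMono a y k.lt_succ_self)
  have hle (k : ℕ) : k ≤ blockPos a y k := (blockPos_strictMono a y).le_apply
  obtain ⟨k, rfl | ⟨rfl, hk⟩⟩ := exists_eq_blockPos a y j
  · refine ⟨k, hle k, fun h2 h0 => ?_, fun b hb => ?_, ?_, ?_⟩
    · obtain rfl | hk := Nat.eq_zero_or_pos k
      · simp [blockPos] at h2
      · exact hlow k hk h0
    · simp [h.letterCount_blockPos, hb]
    all_goals simp [h.letterCount_blockPos]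
  · refine ⟨k + 1, Nat.succ_le_succ (hle k), fun h2 h0 => ?_, fun b hb => ?_, ?_, ?_⟩
    · obtain rfl | hk' := Nat.eq_zero_or_pos k
      · simp [blockPos] at h2
      · exact Nat.succ_lt_succ (hlow k hk' h0)
    · rw [letterCount_succ, letterCount_succ, h.letterCount_blockPos, (h k).1, if_neg hb]
    all_goals simp [letterCount_succ, h.letterCount_blockPos, (h k).1, hk]

end Blocks

section LetterBalance

variable {A : Type*} [DecidableEq A]

/-- The difference of the abelianizations of the factors of `x` at `[i, j)` and `[i', j')`. -/
def imbalance (x : ℕ → A) (i j i' j' : ℕ) (b : A) : ℤ :=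
  (letterCount x b j - letterCount x b i) - (letterCount x b j' - letterCount x b i')

lemma imbalance_comm (x : ℕ → A) (i j i' j' : ℕ) :
    imbalance x i' j' i j = -imbalance x i j i' j' := by
  ext b
  simp [imbalance]

variable [Fintype A]

lemma exists_imbalance_succ {a : A} {x y : ℕ → A} (h : IsArImage a x y) (i j i' j' : ℕ) :
    ∃ k l k' l', k + l + k' + l' ≤ i + j + i' + j' ∧
      (y 0 ≠ a → (2 ≤ i ∨ 2 ≤ j ∨ 2 ≤ i' ∨ 2 ≤ j') → k + l + k' + l' < i + j + i' + j') ∧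
      (∀ e ≠ a, imbalance y k l k' l' e = imbalance x i j i' j' e) ∧
      |imbalance x i j i' j' a - ∑ e, imbalance y k l k' l' e| ≤ 2 := by
  obtain ⟨k, h1, h2, h3, h4, h5⟩ := h.exists_roundUp i
  obtain ⟨l, h1', h2', h3', h4', h5'⟩ := h.exists_roundUp j
  obtain ⟨k', g1, g2, g3, g4, g5⟩ := h.exists_roundUp i'
  obtain ⟨l', g1', g2', g3', g4', g5'⟩ := h.exists_roundUp j'
  refine ⟨k, l, k', l', by omega, fun h0 => ?_, fun e he => ?_, ?_⟩
  · simp only [h0, ne_eq, not_false_eq_true, forall_const] at h2 h2' g2 g2'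
    omega
  · rw [imbalance, imbalance, h3 e he, h3' e he, g3 e he, g3' e he]
  · simp only [imbalance, Finset.sum_sub_distrib, ← Nat.cast_sum, abs_le]
    omega

/-- Imbalanced vectors do not arise from an Arnoux–Rauzy word whose directive sequence has no
`C + 1` consecutive equal letters. -/
lemma not_isImbalanced (hA : Fintype.card A = 3) {c : ℕ → A} {C : ℕ}
    (hC : ∀ n, ¬ ∀ j ≤ C, c (n + j) = c n) {X : ℕ → ℕ → A}
    (hX : ∀ n, IsArImage (c n) (X n) (X (n + 1))) {a : A} (ha : ∀ n, X n 0 = a)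
    (hne : ∀ N, ∃ n, N ≤ n ∧ c n ≠ a) (n i j i' j' : ℕ) :
    ¬ IsImbalanced c C n (imbalance (X n) i j i' j') := by
  suffices H : ∀ J t n i j i' j', i + j + i' + j' ≤ J → c (n + t) ≠ a →
      ¬ IsImbalanced c C n (imbalance (X n) i j i' j') by
    obtain ⟨n', hn', h'⟩ := hne n
    exact H _ (n' - n) n i j i' j' le_rfl (by rwa [Nat.add_sub_cancel' hn'])
  intro J
  induction J using Nat.strong_induction_on with
  | _ J ihJ =>
  intro t
  induction t with
  | zero =>
    intro n i j i' j' hJ ht him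
    by_cases h2 : 2 ≤ i ∨ 2 ≤ j ∨ 2 ≤ i' ∨ 2 ≤ j'
    · obtain ⟨k, l, k', l', -, hlt, he, hs⟩ := exists_imbalance_succ (hX n) i j i' j'
      have hlt := hlt (by rw [ha]; exact Ne.symm ht) h2
      obtain ⟨n', hn', h'⟩ := hne (n + 1)
      have ht' : c (n + 1 + (n' - (n + 1))) ≠ a := by rwa [Nat.add_sub_cancel' hn']
      obtain h | h := him.succ hA hC he hs
      · exact ihJ _ (hlt.trans_le hJ) _ _ _ _ _ _ le_rfl ht' h
      · rw [← imbalance_comm] at h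
        exact ihJ _ (hlt.trans_le hJ) _ _ _ _ _ _ (by omega) ht' h
    · obtain ⟨g, hg⟩ := him.exists_ge
      have hle (k : ℕ) : letterCount (X n) g k ≤ k := Nat.count_le _
      have h1 := hle i
      have h2 := hle j
      have h3 := hle i'
      have h4 := hle j'
      rw [imbalance] at hg
      omega
  | succ t iht =>
    intro n i j i' j' hJ ht him
    obtain ⟨k, l, k', l', hle, -, he, hs⟩ := exists_imbalance_succ (hX n) i j i' j'
    rw [show n + (t + 1) = n + 1 + t by omega] at ht
    obtain h | h := him.succ hA hC he hs
    · exact iht _ _ _ _ _ (hle.trans hJ) ht h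
    · rw [← imbalance_comm] at h
      exact iht _ _ _ _ _ (by omega) ht h

/-- Letters are balanced in ternary Arnoux–Rauzy words with bounded weak partial quotients. -/
lemma abs_imbalance_le (hA : Fintype.card A = 3) {c : ℕ → A} {C : ℕ}
    (hC : ∀ n, ¬ ∀ j ≤ C, c (n + j) = c n) {X : ℕ → ℕ → A}
    (hX : ∀ n, IsArImage (c n) (X n) (X (n + 1))) {a : A} (ha : ∀ n, X n 0 = a)
    (hne : ∀ N, ∃ n, N ≤ n ∧ c n ≠ a) (n i i' L : ℕ) (b : A) :
    |imbalance (X n) i (i + L) i' (i' + L) b| ≤ 16 * C + 14 := by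
  have key (i i' : ℕ) : -(16 * C + 14) < imbalance (X n) i (i + L) i' (i' + L) b := by
    by_contra! hlt
    have hsum : ∑ e, imbalance (X n) i (i + L) i' (i' + L) e = 0 := by
      simp only [imbalance, Finset.sum_sub_distrib, ← Nat.cast_sum, sum_letterCount]
      push_cast
      ring
    obtain h | h := isImbalanced_of_sum_eq_zero hA (c := c) (n := n) hsum hlt
    · exact not_isImbalanced hA hC hX ha hne _ _ _ _ _ h
    · rw [← imbalance_comm] at h
      exact not_isImbalanced hA hC hX ha hne _ _ _ _ _ h
  have h1 := key i i'
  have h2 := key i' i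
  rw [imbalance_comm, Pi.neg_apply] at h2
  rw [abs_le]
  omega

end LetterBalance

/-! ### Cutting positions and block lengths -/

section Cuts

variable {A : Type*} [DecidableEq A]

/-- The length of the image of the letter `b` under `n` consecutive Arnoux–Rauzy substitutions,
the first of which has index `m`. -/
def blockLength (c : ℕ → A) (m : ℕ) : ℕ → A → ℕ
  | 0, _ => 1
  | n + 1, b => blockLength c m n b + if b = c (m + n) then 0 else blockLength c m n (c (m + n))

/-- The position in the word of level `m` of the image of the `k`-th letter of the word of level
`m + n`. -/
def cutPos (c : ℕ → A) (X : ℕ → ℕ → A) (m : ℕ) : ℕ → ℕ → ℕ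
  | 0, k => k
  | n + 1, k => cutPos c X m n (blockPos (c (m + n)) (X (m + n + 1)) k)

variable {c : ℕ → A} {X : ℕ → ℕ → A}

lemma cutPos_succ_outer (m n k : ℕ) :
    cutPos c X m (n + 1) k = blockPos (c m) (X (m + 1)) (cutPos c X (m + 1) n k) := by
  induction n generalizing k with
  | zero => rfl
  | succ n ih =>
    rw [cutPos, ih, cutPos, Nat.add_right_comm m 1 n]
    rfl

lemma cutPos_strictMono (m n : ℕ) : StrictMono (cutPos c X m n) := by
  induction n with
  | zero => exact strictMono_id
  | succ n ih => exact ih.comp (blockPos_strictMono _ _)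

lemma cutPos_zero (m n : ℕ) : cutPos c X m n 0 = 0 := by
  induction n with
  | zero => rfl
  | succ n ih => exact ih

lemma blockLength_pos (m n : ℕ) (b : A) : 0 < blockLength c m n b := by
  induction n with
  | zero => exact Nat.one_pos
  | succ n ih => exact Nat.add_pos_left ih _

lemma apply_cutPos (hX : ∀ n, IsArImage (c n) (X n) (X (n + 1))) (m n k : ℕ) :
    X m (cutPos c X m n k) = X (m + n) k := by
  induction n generalizing k with
  | zero => rfl
  | succ n ih => rw [cutPos, ih, (hX (m + n) k).1, add_assoc]

lemma cutPos_succ (hX : ∀ n, IsArImage (c n) (X n) (X (n + 1))) (m n k : ℕ) :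
    cutPos c X m n (k + 1) = cutPos c X m n k + blockLength c m n (X (m + n) k) := by
  induction n generalizing k with
  | zero => rfl
  | succ n ih =>
    rw [cutPos, cutPos, blockLength, ← add_assoc m n 1, blockPos]
    split_ifs with h
    · rw [ih, (hX (m + n) k).1, add_zero]
    · rw [← one_add_one_eq_two, ← add_assoc, ih, ih, (hX (m + n) k).1, (hX (m + n) k).2 h,
        add_assoc]

/-- The block of level `n` starting at a cutting position only depends on the letter there. -/
lemma apply_cutPos_add (hX : ∀ n, IsArImage (c n) (X n) (X (n + 1))) (m n k k' : ℕ)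
    (h : X (m + n) k = X (m + n) k') (l : ℕ)
    (hl : l < blockLength c m n (X (m + n) k)) :
    X m (cutPos c X m n k + l) = X m (cutPos c X m n k' + l) := by
  induction n generalizing k k' l with
  | zero =>
    obtain rfl : l = 0 := by simpa [blockLength] using hl
    exact h
  | succ n ih =>
    rw [← add_assoc m n 1] at h hl
    have e := (hX (m + n) k)
    have e' := (hX (m + n) k')
    rw [cutPos, cutPos]
    by_cases hlt : l < blockLength c m n (X (m + n + 1) k)
    · exact ih _ _ (by rw [e.1, e'.1, h]) _ (by rwa [e.1])
    · rw [blockLength] at hl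
      split_ifs at hl with hk
      · omega
      · have s := cutPos_succ hX m n (blockPos (c (m + n)) (X (m + n + 1)) k)
        have s' := cutPos_succ hX m n (blockPos (c (m + n)) (X (m + n + 1)) k')
        rw [e.1] at s
        rw [e'.1, ← h] at s'
        have := ih _ _ ((e.2 hk).trans (e'.2 (h ▸ hk)).symm)
          (l - blockLength c m n (X (m + n + 1) k)) (by rw [e.2 hk]; omega)
        rw [s, s'] at this
        convert this using 2 <;> omega

lemma cutPos_eq_sum (hX : ∀ n, IsArImage (c n) (X n) (X (n + 1))) [Fintype A] (m n k : ℕ) :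
    cutPos c X m n k = ∑ b, blockLength c m n b * letterCount (X (m + n)) b k := by
  induction k with
  | zero => simp [cutPos_zero, letterCount]
  | succ k ih => simp [cutPos_succ hX, ih, letterCount_succ, mul_add, Finset.sum_add_distrib]

lemma exists_letter_ge (hX : ∀ n, IsArImage (c n) (X n) (X (n + 1)))
    (hdir : ∀ b : A, ∀ N : ℕ, ∃ n, N ≤ n ∧ c n = b) (n : ℕ) (b : A) (N : ℕ) :
    ∃ k, N ≤ k ∧ X n k = b := by
  obtain ⟨n', hn', rfl⟩ := hdir b n
  obtain ⟨t, rfl⟩ := Nat.exists_eq_add_of_le hn'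
  obtain ⟨k, hk, hk'⟩ : ∃ k, N ≤ k ∧ X (n + t) k = c (n + t) := by
    refine ⟨blockPos (c (n + t)) (X (n + t + 1)) (N + 1) - 1, ?_, ?_⟩
    · have := (blockPos_strictMono (c (n + t)) (X (n + t + 1))).le_apply (x := N + 1)
      omega
    · rw [← (hX (n + t)).exists_succ_eq_iff]
      have := (blockPos_strictMono (c (n + t)) (X (n + t + 1))).le_apply (x := N + 1)
      exact ⟨N + 1, by omega⟩
  exact ⟨cutPos c X n t k, hk.trans (cutPos_strictMono n t).le_apply,
    (apply_cutPos hX n t k).trans hk'⟩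

/-- Prefixes of the word of level `0` recur infinitely often. -/
lemma exists_prefix_eq (hX : ∀ n, IsArImage (c n) (X n) (X (n + 1)))
    (hdir : ∀ b : A, ∀ N : ℕ, ∃ n, N ≤ n ∧ c n = b) {a : A} (ha : ∀ n, X n 0 = a)
    (hne : ∀ N, ∃ n, N ≤ n ∧ c n ≠ a) (L N : ℕ) :
    ∃ k, N ≤ k ∧ ∀ l < L, X 0 (k + l) = X 0 l := by
  obtain ⟨n, hn⟩ : ∃ n, L ≤ blockLength c 0 n a := by
    have hmono : Monotone fun n => blockLength c 0 n a :=
      monotone_nat_of_le_succ fun n => by rw [blockLength]; omega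
    induction L with
    | zero => exact ⟨0, Nat.zero_le _⟩
    | succ L ih =>
      obtain ⟨n, hn⟩ := ih
      obtain ⟨n', h', hne'⟩ := hne n
      refine ⟨n' + 1, ?_⟩
      have h1 := hmono h'
      have h2 := blockLength_pos (c := c) 0 n' (c (0 + n'))
      rw [blockLength, if_neg (by rw [zero_add]; exact Ne.symm hne')]
      simp only at h1
      omega
  obtain ⟨k, hk, hka⟩ := exists_letter_ge hX hdir (0 + n) a N
  refine ⟨cutPos c X 0 n k, hk.trans (cutPos_strictMono 0 n).le_apply, fun l hl => ?_⟩
  rw [apply_cutPos_add hX 0 n k 0 (by rw [hka, ha]) l (by rw [hka]; omega), cutPos_zero, zero_add]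

end Cuts

section BlockLength

variable {A : Type*} [DecidableEq A] {c : ℕ → A}

lemma blockLength_le_add (m n : ℕ) (b : A) {b₁ b₂ : A} (h : b₁ ≠ b₂) :
    blockLength c m n b ≤ blockLength c m n b₁ + blockLength c m n b₂ := by
  induction n generalizing b b₁ b₂ with
  | zero => simp [blockLength]
  | succ n ih =>
    have h0 := ih b h
    rcases eq_or_ne b₁ (c (m + n)) with h1 | h1
    · have h2 : b₂ ≠ c (m + n) := h1 ▸ h.symm
      rw [h1] at h0
      simp only [blockLength, h1, h2, if_true, if_false]
      split_ifs <;> omega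
    · simp only [blockLength, h1, if_false]
      split_ifs <;> omega

lemma blockLength_succ_self (c : ℕ → A) (m n : ℕ) :
    blockLength c m (n + 1) (c (m + n)) = blockLength c m n (c (m + n)) := by
  rw [blockLength, if_pos rfl, add_zero]

lemma blockLength_succ_of_ne {m n : ℕ} {b : A} (h : b ≠ c (m + n)) :
    blockLength c m (n + 1) b = blockLength c m n b + blockLength c m n (c (m + n)) := by
  rw [blockLength, if_neg h]

lemma exists_run_blockLength_le [Nontrivial A] (c : ℕ → A) (m n : ℕ) :
    ∃ s ≤ n, (∀ i, s ≤ i → i ≤ n → c (m + i) = c (m + n)) ∧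
      (∀ b, blockLength c m (n + 1) (c (m + n)) ≤ blockLength c m (n + 1) b) ∧
      ∃ b ≠ c (m + n), blockLength c m (n + 1) b ≤
        (n - s + 2) * blockLength c m (n + 1) (c (m + n)) := by
  induction n with
  | zero =>
    obtain ⟨b, hb⟩ := exists_ne (c (m + 0))
    refine ⟨0, le_rfl, fun i _ hi => by rw [Nat.le_zero.1 hi], fun b => ?_, b, hb, ?_⟩
    · simp [blockLength]
    · rw [blockLength, blockLength, if_neg hb]
      simp [blockLength]
  | succ n ih =>
    obtain ⟨s, hs, hrun, hmin, b, hb, hle⟩ := ih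
    by_cases h : c (m + (n + 1)) = c (m + n)
    · refine ⟨s, by omega, fun i h1 h2 => ?_, fun e => ?_, b, by rwa [h], ?_⟩
      · obtain h2 | rfl := Nat.le_succ_iff.1 h2
        · rw [hrun i h1 h2, h]
        · rfl
      · rw [blockLength_succ_self, h]
        exact (hmin e).trans (Nat.le_add_right _ _)
      · rw [blockLength_succ_of_ne (by rwa [h]), blockLength_succ_self, h,
          show n + 1 - s + 2 = (n - s + 2) + 1 by omega, add_one_mul]
        exact Nat.add_le_add_right hle _
    · refine ⟨n + 1, le_rfl, fun i h1 h2 => by rw [le_antisymm h2 h1], fun e => ?_,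
        c (m + n), Ne.symm h, ?_⟩
      · rw [blockLength_succ_self]
        obtain rfl | he := eq_or_ne e (c (m + (n + 1)))
        · rw [blockLength_succ_self]
        · rw [blockLength_succ_of_ne he]
          exact Nat.le_add_left _ _
      · have := hmin (c (m + (n + 1)))
        rw [blockLength_succ_of_ne (Ne.symm h), blockLength_succ_self c m (n + 1),
          Nat.sub_self]
        omega

/-- If `c` has no `C + 1` consecutive equal letters, the block lengths of a given level are
comparable. -/
lemma blockLength_le_mul [Nontrivial A] {C : ℕ} (hC : ∀ n, ¬ ∀ j ≤ C, c (n + j) = c n)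
    (n : ℕ) (b b' : A) : blockLength c 0 n b ≤ (C + 2) * blockLength c 0 n b' := by
  cases n with
  | zero => simp [blockLength]
  | succ n =>
    obtain ⟨s, hs, hrun, hmin, e, he, hle⟩ := exists_run_blockLength_le c 0 n
    simp only [zero_add] at hrun hmin he hle
    have hsC : n < s + C := by
      by_contra! hlt
      exact hC s fun j hj => by rw [hrun _ (by omega) (by omega), hrun s le_rfl hs]
    calc blockLength c 0 (n + 1) b
        ≤ blockLength c 0 (n + 1) e + blockLength c 0 (n + 1) (c n) := blockLength_le_add 0 _ b he
      _ ≤ (n - s + 2) * blockLength c 0 (n + 1) (c n) + blockLength c 0 (n + 1) (c n) :=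
        Nat.add_le_add_right hle _
      _ = (n - s + 2 + 1) * blockLength c 0 (n + 1) (c n) := by ring
      _ ≤ (C + 2) * blockLength c 0 (n + 1) b' := Nat.mul_le_mul (by omega) (hmin b')

end BlockLength

/-! ### Occurrences of factors correspond to cutting positions -/

section Occurrences

variable {A : Type*}

lemma occursAt_nil (x : ℕ → A) (i : ℕ) : OccursAt x [] i := rfl

lemma occursAt_cons {x : ℕ → A} {b : A} {w : List A} {i : ℕ} :
    OccursAt x (b :: w) i ↔ x i = b ∧ OccursAt x w (i + 1) := by
  simp only [OccursAt, List.length_cons, List.range_succ_eq_map, List.map_cons, List.map_map,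
    List.cons.injEq, add_zero, Function.comp_def, Nat.succ_eq_add_one, add_assoc, add_comm 1]
  exact and_congr_left' eq_comm

lemma occursAt_append {x : ℕ → A} {u v : List A} {i : ℕ} :
    OccursAt x (u ++ v) i ↔ OccursAt x u i ∧ OccursAt x v (i + u.length) := by
  induction u generalizing i with
  | nil => simp [occursAt_nil]
  | cons b u ih =>
    rw [List.cons_append, occursAt_cons, ih, occursAt_cons, and_assoc, List.length_cons,
      add_assoc, add_comm 1]

lemma occursAt_iff {x : ℕ → A} {w : List A} {i : ℕ} :
    OccursAt x w i ↔ ∀ l (h : l < w.length), w[l] = x (i + l) := by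
  rw [OccursAt, List.ext_getElem_iff]
  simp

variable [DecidableEq A] {a : A} {x y : ℕ → A}

lemma IsArImage.occursAt_substWord (h : IsArImage a x y) {g : List A} {k : ℕ}
    (hg : OccursAt y g k) :
    OccursAt x (substWord (arSubst a) g) (blockPos a y k) ∧
      blockPos a y (k + g.length) = blockPos a y k + (substWord (arSubst a) g).length := by
  induction g generalizing k with
  | nil => exact ⟨rfl, rfl⟩
  | cons b g ih =>
    obtain ⟨rfl, hg'⟩ := occursAt_cons.1 hg
    obtain ⟨h1, h2⟩ := ih hg'
    have e : substWord (arSubst a) (y k :: g) = arSubst a (y k) ++ substWord (arSubst a) g := rfl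
    have hlen : blockPos a y (k + 1) = blockPos a y k + (arSubst a (y k)).length := by
      rw [blockPos, arSubst]
      split_ifs <;> rfl
    rw [e, occursAt_append, List.length_append, List.length_cons, add_comm g.length, ← add_assoc k,
      h2, hlen, add_assoc]
    refine ⟨⟨?_, hlen ▸ h1⟩, rfl⟩
    rw [arSubst]
    split_ifs with hk
    · exact occursAt_cons.2 ⟨hk ▸ (h k).1, occursAt_nil _ _⟩
    · exact occursAt_cons.2 ⟨(h k).1, occursAt_cons.2 ⟨(h k).2 hk, occursAt_nil _ _⟩⟩

/-- Desubstitution of a word occurring at the beginning of a block. -/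
lemma IsArImage.exists_desubst (h : IsArImage a x y) (w : List A) :
    (∀ k, ¬ OccursAt x w (blockPos a y k)) ∨
      ∃ w' : List A, w'.length ≤ w.length ∧
        ∀ k, OccursAt x w (blockPos a y k) ↔ OccursAt y w' k := by
  induction hw : w.length using Nat.strong_induction_on generalizing w with
  | _ ℓ ih =>
  subst hw
  have hcons (e : A) (v : List A) (hv : v.length < w.length)
      (hk : ∀ k, OccursAt x w (blockPos a y k) ↔
        y k = e ∧ OccursAt x v (blockPos a y (k + 1))) :
      (∀ k, ¬ OccursAt x w (blockPos a y k)) ∨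
      ∃ w' : List A, w'.length ≤ w.length ∧
        ∀ k, OccursAt x w (blockPos a y k) ↔ OccursAt y w' k := by
    obtain hn | ⟨v', hv', hn⟩ := ih v.length hv v rfl
    · exact Or.inl fun k hocc => hn (k + 1) ((hk k).1 hocc).2
    · exact Or.inr ⟨e :: v', by simp only [List.length_cons]; omega, fun k => by
        rw [hk, hn, occursAt_cons]⟩
  obtain _ | ⟨b, w⟩ := w
  · exact Or.inr ⟨[], le_rfl, fun k => Iff.rfl⟩
  by_cases hb : b = a
  · refine hcons b w (by simp) fun k => ?_
    rw [occursAt_cons, (h k).1]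
    exact and_congr_right fun hk => by rw [blockPos, if_pos (hk.trans hb)]
  obtain _ | ⟨e, w⟩ := w
  · exact Or.inr ⟨[b], le_rfl, fun k => by simp [occursAt_cons, occursAt_nil, (h k).1]⟩
  by_cases he : e = a
  · refine hcons b w (by simp) fun k => ?_
    rw [occursAt_cons, occursAt_cons, (h k).1]
    refine and_congr_right fun hk => ?_
    have hk' : y k ≠ a := fun hk' => hb (hk.symm.trans hk')
    rw [blockPos, if_neg hk', (h k).2 hk', he, eq_self_iff_true, true_and]
  · refine Or.inl fun k hocc => ?_
    rw [occursAt_cons, occursAt_cons, (h k).1] at hocc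
    exact he (hocc.2.1.symm.trans ((h k).2 fun hk => hb (hocc.1.symm.trans hk)))

/-- The occurrences of `w` in the word of level `m` are finitely many, or are given by the cutting
positions of some level `m + n`. -/
def OccursAtCuts (c : ℕ → A) (X : ℕ → ℕ → A) (m : ℕ) (w : List A) : Prop :=
  (∃ N, ∀ i ≥ N, ¬ OccursAt (X m) w i) ∨
    ∃ (n N : ℕ) (g : List A),
      (∀ i ≥ N, OccursAt (X m) w i ↔ ∃ k, i + g.length = cutPos c X m n k) ∧
      ∀ i ≥ N, OccursAt (X m) w i → OccursAt (X m) g i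

variable {c : ℕ → A} {X : ℕ → ℕ → A}

lemma OccursAtCuts.of_succ (hX : ∀ n, IsArImage (c n) (X n) (X (n + 1))) {m : ℕ} {w w' p : List A}
    (h : OccursAtCuts c X (m + 1) w')
    (hw : ∀ i, OccursAt (X m) w i ↔
      ∃ k, i + p.length = blockPos (c m) (X (m + 1)) k ∧ OccursAt (X (m + 1)) w' k)
    (hp : ∀ i, OccursAt (X m) w i → OccursAt (X m) p i) : OccursAtCuts c X m w := by
  have hmono := blockPos_strictMono (c m) (X (m + 1))
  obtain ⟨N, hN⟩ | ⟨n, N, g, hN, hg⟩ := h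
  · refine Or.inl ⟨blockPos (c m) (X (m + 1)) N, fun i hi hocc => ?_⟩
    obtain ⟨k, hk, hk'⟩ := (hw i).1 hocc
    exact hN k (hmono.le_iff_le.1 (by omega)) hk'
  · have key (i : ℕ) (hi : i ≥ blockPos (c m) (X (m + 1)) (N + g.length)) :
        OccursAt (X m) w i → ∃ k, i + p.length = blockPos (c m) (X (m + 1)) k ∧
          OccursAt (X (m + 1)) w' k ∧ N ≤ k := by
      intro hocc
      obtain ⟨k, hk, hk'⟩ := (hw i).1 hocc
      have : N + g.length ≤ k := hmono.le_iff_le.1 (by omega)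
      exact ⟨k, hk, hk', by omega⟩
    refine Or.inr ⟨n + 1, blockPos (c m) (X (m + 1)) (N + g.length),
      p ++ substWord (arSubst (c m)) g, fun i hi => ⟨fun hocc => ?_, ?_⟩, fun i hi hocc => ?_⟩
    · obtain ⟨k, hk, hk', hNk⟩ := key i hi hocc
      obtain ⟨K, hK⟩ := (hN k hNk).1 hk'
      refine ⟨K, ?_⟩
      rw [cutPos_succ_outer, ← hK, ((hX m).occursAt_substWord (hg k hNk hk')).2, ← hk,
        List.length_append, add_assoc]
    · rintro ⟨K, hK⟩
      rw [cutPos_succ_outer] at hK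
      have hle : N + g.length ≤ cutPos c X (m + 1) n K := hmono.le_iff_le.1 (by omega)
      have hk' : OccursAt (X (m + 1)) w' (cutPos c X (m + 1) n K - g.length) :=
        (hN _ (by omega)).2 ⟨K, by omega⟩
      refine (hw i).2 ⟨_, ?_, hk'⟩
      have := ((hX m).occursAt_substWord (hg _ (by omega) hk')).2
      rw [Nat.sub_add_cancel (by omega), ← hK, List.length_append] at this
      omega
    · obtain ⟨k, hk, hk', hNk⟩ := key i hi hocc
      rw [occursAt_append, hk]
      exact ⟨hp i hocc, ((hX m).occursAt_substWord (hg k hNk hk')).1⟩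

lemma occursAtCuts (hX : ∀ n, IsArImage (c n) (X n) (X (n + 1)))
    (hdir : ∀ b : A, ∀ N : ℕ, ∃ n, N ≤ n ∧ c n = b) (m : ℕ) (w : List A) :
    OccursAtCuts c X m w := by
  induction hw : w.length using Nat.strong_induction_on generalizing w m with
  | _ ℓ ih =>
  subst hw
  obtain _ | ⟨b, w⟩ := w
  · exact Or.inr ⟨0, 0, [], fun i _ => ⟨fun _ => ⟨i, rfl⟩, fun _ => occursAt_nil _ _⟩,
      fun i _ h => h⟩
  have hself (m : ℕ) (hb : b = c m) : OccursAtCuts c X m (b :: w) := by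
    have hw (i : ℕ) : OccursAt (X m) (b :: w) i ↔
        ∃ k, i + [b].length = blockPos (c m) (X (m + 1)) k ∧
          OccursAt (X m) w (blockPos (c m) (X (m + 1)) k) := by
      rw [occursAt_cons, hb, ← (hX m).exists_succ_eq_iff]
      constructor
      · rintro ⟨⟨k, hk⟩, h⟩
        exact ⟨k, hk, hk ▸ h⟩
      · rintro ⟨k, hk, h⟩
        exact ⟨⟨k, hk⟩, hk.symm ▸ h⟩
    obtain hn | ⟨w', hw', hn⟩ := (hX m).exists_desubst w
    · exact Or.inl ⟨0, fun i _ hocc => by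
        obtain ⟨k, -, hk⟩ := (hw i).1 hocc
        exact hn k hk⟩
    · simp only [hn] at hw
      exact (ih w'.length (by simp only [List.length_cons]; omega) (m + 1) w' rfl).of_succ hX hw
        fun i hocc => occursAt_cons.2 ⟨(occursAt_cons.1 hocc).1, occursAt_nil _ _⟩
  obtain ⟨n, hn, hnb⟩ := hdir b m
  obtain ⟨t, rfl⟩ := Nat.exists_eq_add_of_le hn
  clear hn
  induction t generalizing m with
  | zero => exact hself m hnb.symm
  | succ t iht =>
    by_cases hb : b = c m
    · exact hself m hb
    have hw (i : ℕ) : OccursAt (X m) (b :: w) i ↔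
        ∃ k, i + ([] : List A).length = blockPos (c m) (X (m + 1)) k ∧
          OccursAt (X m) (b :: w) (blockPos (c m) (X (m + 1)) k) := by
      constructor
      · intro h
        obtain ⟨k, hk⟩ := (hX m).exists_eq_of_ne ((occursAt_cons.1 h).1.trans_ne hb)
        exact ⟨k, hk, hk ▸ h⟩
      · rintro ⟨k, hk, h⟩
        rw [List.length_nil, add_zero] at hk
        exact hk ▸ h
    have hnil (i : ℕ) (_ : OccursAt (X m) (b :: w) i) : OccursAt (X m) [] i := occursAt_nil _ _
    obtain _ | ⟨e, w⟩ := w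
    · simp only [occursAt_cons, occursAt_nil, and_true, ((hX m) _).1] at hw
      refine (iht (m + 1) (by rw [← hnb]; congr 1; omega)).of_succ hX (fun i => ?_) hnil
      simp only [occursAt_cons, occursAt_nil, and_true, hw]
    have hiff (k : ℕ) : OccursAt (X m) (b :: e :: w) (blockPos (c m) (X (m + 1)) k) ↔
        X (m + 1) k = b ∧ e = c m ∧
          OccursAt (X m) w (blockPos (c m) (X (m + 1)) (k + 1)) := by
      rw [occursAt_cons, occursAt_cons, (hX m k).1]
      refine and_congr_right fun hk => ?_
      have hk' : X (m + 1) k ≠ c m := hk.trans_ne hb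
      rw [blockPos, if_neg hk', (hX m k).2 hk', eq_comm]
    simp only [hiff] at hw
    by_cases he : e = c m
    · obtain hn | ⟨w', hw', hn⟩ := (hX m).exists_desubst w
      · exact Or.inl ⟨0, fun i _ hocc => by
          obtain ⟨k, -, -, -, hk⟩ := (hw i).1 hocc
          exact hn _ hk⟩
      · simp only [hn, he, true_and, ← occursAt_cons] at hw hnil
        exact he ▸ (ih (b :: w').length (by simp only [List.length_cons]; omega) (m + 1) _
          rfl).of_succ hX hw hnil
    · exact Or.inl ⟨0, fun i _ hocc => by
        obtain ⟨k, -, -, hk, -⟩ := (hw i).1 hocc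
        exact he hk⟩

end Occurrences

/-! ### Bounded weak partial quotients imply uniform factor balance -/

section Counting

variable {A : Type*}

lemma OccursAt.countOccs_eq {x : ℕ → A} {u : List A} {i : ℕ} (hu : OccursAt x u i) (w : List A) :
    countOccs u w = Nat.count (fun r => OccursAt x w (i + r)) (u.length + 1 - w.length) := by
  rw [countOccs, Nat.count_eq_card_filter_range]
  congr 1
  ext r
  simp only [Finset.mem_filter, Finset.mem_range]
  rw [List.prefix_iff_getElem, occursAt_iff]
  rw [occursAt_iff] at hu
  constructor
  · rintro ⟨hr, hle, h⟩
    rw [List.length_drop] at hle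
    refine ⟨by omega, fun l hl => ?_⟩
    rw [h l hl, List.getElem_drop, hu _ (by omega), add_assoc]
  · rintro ⟨hr, h⟩
    refine ⟨by omega, by rw [List.length_drop]; omega, fun l hl => ?_⟩
    rw [h l hl, List.getElem_drop, hu _ (by omega), add_assoc]

lemma lt_count_iff {f : ℕ → ℕ} (hf : StrictMono f) (j k : ℕ) :
    k < Nat.count (fun i => ∃ k, i = f k) j ↔ f k < j := by
  induction j generalizing k with
  | zero => simp
  | succ j ih =>
    rw [Nat.count_succ]
    split_ifs with hj
    · obtain ⟨k₀, rfl⟩ := hj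
      have h₀ : Nat.count (fun i => ∃ k, i = f k) (f k₀) = k₀ := by
        refine eq_of_forall_lt_iff fun k => ?_
        rw [ih, hf.lt_iff_lt]
      rw [h₀, Nat.lt_succ_iff, Nat.lt_succ_iff, hf.le_iff_le]
    · have : f k ≠ j := fun h => hj ⟨k, h.symm⟩
      rw [add_zero, ih]
      omega

/-- Windows of equal length contain nearly the same number of terms of a sequence with balanced
increments. -/
lemma count_le_count_add {f : ℕ → ℕ} (hf : StrictMono f) (hf0 : f 0 = 0) {q S : ℕ}
    (hq : ∀ k, f k + q ≤ f (k + 1))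
    (hS : ∀ p p' r, f (p + r) + f p' ≤ f (p' + r) + f p + S * q) (j j' M : ℕ) :
    Nat.count (fun r => ∃ k, j + r = f k) M ≤
      Nat.count (fun r => ∃ k, j' + r = f k) M + (S + 1) := by
  have hstep (k s : ℕ) : f k + s * q ≤ f (k + s) := by
    induction s with
    | zero => simp
    | succ s ih =>
      have := hq (k + s)
      rw [← add_assoc, add_one_mul]
      omega
  have h1 := Nat.count_add (fun i => ∃ k, i = f k) j M
  have h2 := Nat.count_add (fun i => ∃ k, i = f k) j' M
  have hlt := lt_count_iff hf
  set l₀ := Nat.count (fun i => ∃ k, i = f k) j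
  set l₁ := Nat.count (fun i => ∃ k, i = f k) (j + M)
  set k₀ := Nat.count (fun i => ∃ k, i = f k) j' with hk₀
  set k₁ := Nat.count (fun i => ∃ k, i = f k) (j' + M) with hk₁
  by_contra! hcon
  have hl : f (l₁ - 1) < j + M := (hlt _ _).1 (by omega)
  have hl' : j ≤ f l₀ := not_lt.1 fun h => lt_irrefl _ ((hlt _ _).2 h)
  have hk : j' + M ≤ f k₁ := not_lt.1 fun h => lt_irrefl _ ((hlt _ _).2 h)
  have hk' : f (k₀ - 1) ≤ j' := by
    rcases Nat.eq_zero_or_pos k₀ with h | h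
    · simp [h, hf0]
    · exact ((hlt _ _).1 (by omega)).le
  have hr := hS (k₀ - 1) l₀ (k₁ - (k₀ - 1))
  rw [Nat.add_sub_cancel' (by omega)] at hr
  have hs := hstep (l₀ + (k₁ - (k₀ - 1))) S
  have hm : f (l₀ + (k₁ - (k₀ - 1)) + S) ≤ f (l₁ - 1) := hf.monotone (by omega)
  omega

variable [DecidableEq A] {c : ℕ → A} {X : ℕ → ℕ → A}

lemma exists_cutPos_add_le [Fintype A] (hA : Fintype.card A = 3) {C : ℕ}
    (hC : ∀ n, ¬ ∀ j ≤ C, c (n + j) = c n) (hX : ∀ n, IsArImage (c n) (X n) (X (n + 1))) {a : A}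
    (ha : ∀ n, X n 0 = a) (hne : ∀ N, ∃ n, N ≤ n ∧ c n ≠ a) (n : ℕ) :
    ∃ q, (∀ k, cutPos c X 0 n k + q ≤ cutPos c X 0 n (k + 1)) ∧
      ∀ p p' r, cutPos c X 0 n (p + r) + cutPos c X 0 n p' ≤
        cutPos c X 0 n (p' + r) + cutPos c X 0 n p + 3 * (C + 2) * (16 * C + 14) * q := by
  have : Nontrivial A := Fintype.one_lt_card_iff_nontrivial.1 (by omega)
  obtain ⟨b₀, hb₀⟩ := Finite.exists_min (blockLength c 0 n)
  refine ⟨blockLength c 0 n b₀, fun k => ?_, fun p p' r => ?_⟩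
  · rw [cutPos_succ hX]
    exact Nat.add_le_add_left (hb₀ _) _
  have key : ∑ b, (blockLength c 0 n b : ℤ) * imbalance (X (0 + n)) p (p + r) p' (p' + r) b ≤
      ∑ _b : A, (((C + 2) * blockLength c 0 n b₀ : ℕ) : ℤ) * (16 * C + 14) := by
    refine Finset.sum_le_sum fun b _ => ?_
    have h1 := (le_abs_self _).trans
      (abs_imbalance_le hA hC hX ha hne (0 + n) p p' r b)
    have h2 : (blockLength c 0 n b : ℤ) ≤ (((C + 2) * blockLength c 0 n b₀ : ℕ) : ℤ) :=
      Int.ofNat_le.2 (blockLength_le_mul hC n b b₀)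
    exact (mul_le_mul_of_nonneg_left h1 (by positivity)).trans
      (mul_le_mul_of_nonneg_right h2 (by positivity))
  simp only [imbalance, mul_sub, Finset.sum_sub_distrib, Finset.sum_const, Finset.card_univ,
    hA, nsmul_eq_mul] at key
  zify
  simp only [cutPos_eq_sum hX]
  push_cast at key ⊢
  linarith

theorem exists_forall_countOccs_le [Fintype A] (hA : Fintype.card A = 3) {C : ℕ}
    (hC : ∀ n, ¬ ∀ j ≤ C, c (n + j) = c n) (hX : ∀ n, IsArImage (c n) (X n) (X (n + 1))) {a : A}
    (ha : ∀ n, X n 0 = a) (hdir : ∀ b : A, ∀ N : ℕ, ∃ n, N ≤ n ∧ c n = b)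
    (hne : ∀ N, ∃ n, N ≤ n ∧ c n ≠ a) :
    ∃ K : ℕ, ∀ w u v : List A, IsFactor (X 0) u → IsFactor (X 0) v → u.length = v.length →
      countOccs u w ≤ countOccs v w + K := by
  have hrec {u : List A} (hu : IsFactor (X 0) u) (N : ℕ) : ∃ i ≥ N, OccursAt (X 0) u i := by
    obtain ⟨i, hi⟩ := hu
    obtain ⟨k, hk, hk'⟩ := exists_prefix_eq hX hdir ha hne (i + u.length) N
    rw [occursAt_iff] at hi
    refine ⟨k + i, by omega, occursAt_iff.2 fun l hl => ?_⟩
    rw [hi l hl, add_assoc, hk' _ (by omega)]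
  refine ⟨3 * (C + 2) * (16 * C + 14) + 1, fun w u v hu hv huv => ?_⟩
  obtain ⟨N, hN⟩ | ⟨n, N, g, hN, -⟩ := occursAtCuts hX hdir 0 w
  · obtain ⟨i, hi, hui⟩ := hrec hu N
    have h0 : countOccs u w = 0 := by
      rw [hui.countOccs_eq, Nat.count_iff_forall_not]
      exact fun r _ => hN _ (by omega)
    omega
  · have hcount {u : List A} (hu : IsFactor (X 0) u) : ∃ j, countOccs u w =
        Nat.count (fun r => ∃ k, j + r = cutPos c X 0 n k) (u.length + 1 - w.length) := by
      obtain ⟨i, hi, hui⟩ := hrec hu N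
      refine ⟨i + g.length, ?_⟩
      rw [hui.countOccs_eq]
      congr 1
      ext r
      rw [hN _ (by omega), add_right_comm]
    obtain ⟨j, hj⟩ := hcount hu
    obtain ⟨j', hj'⟩ := hcount hv
    obtain ⟨q, hq, hS⟩ := exists_cutPos_add_le hA hC hX ha hne n
    rw [hj, hj', huv]
    exact count_le_count_add (cutPos_strictMono 0 n) (cutPos_zero 0 n) hq hS j j' _

end Counting

/-! ### Uniform factor balance implies bounded weak partial quotients -/

section Unbalanced

variable {A : Type*}

lemma occursAt_map_range (x : ℕ → A) (i L : ℕ) :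
    OccursAt x ((List.range L).map fun j => x (i + j)) i := by
  simp [OccursAt]

/-- A repetition of exponent `2 * k + 2` that cannot be prolonged to the right breaks `K`-balance
for all `K < k + 1`. -/
lemma not_balancedIn_of_period {x : ℕ → A} {s p k : ℕ} (hp : 0 < p)
    (hper : ∀ l < (2 * k + 1) * p, x (s + l) = x (s + l + p))
    (hbreak : x (s + (2 * k + 1) * p) ≠ x (s + (2 * k + 1) * p + p)) {K : ℝ} (hK : K < k + 1) :
    ∃ w, ¬ BalancedIn K w x := by
  refine ⟨(List.range ((k + 2) * p)).map fun j => x (s + j), fun hbal => ?_⟩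
  have hT : (2 * k + 1) * p = k * p + k * p + p := by ring
  have hk : (k + 2) * p = k * p + p + p := by ring
  have hu := occursAt_map_range x s ((2 * k + 2) * p)
  have hv := occursAt_map_range x (s + k * p + 1) ((2 * k + 2) * p)
  have hlen : (2 * k + 2) * p + 1 - (k + 2) * p = k * p + 1 := by
    have : (2 * k + 2) * p = k * p + k * p + p + p := by ring
    omega
  have h := hbal _ _ ⟨_, hu⟩ ⟨_, hv⟩ (by simp)
  rw [hu.countOccs_eq, hv.countOccs_eq] at h
  simp only [List.length_map, List.length_range, hlen, occursAt_iff, List.getElem_map,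
    List.getElem_range] at h
  have h0 : Nat.count (fun r => ∀ l < (k + 2) * p, x (s + l) = x (s + k * p + 1 + r + l))
      (k * p + 1) = 0 := by
    refine Nat.count_iff_forall_not.2 fun r hr hocc => hbreak ?_
    have h1 := hocc (k * p + p + p - 1 - r) (by omega)
    have h2 := hocc (k * p + p - 1 - r) (by omega)
    have h3 := hper (k * p + p - 1 - r) (by omega)
    rw [show s + (2 * k + 1) * p = s + k * p + 1 + r + (k * p + p - 1 - r) by omega, ← h2, h3,
      show s + k * p + 1 + r + (k * p + p - 1 - r) + p =
        s + k * p + 1 + r + (k * p + p + p - 1 - r) by omega, ← h1]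
    congr 1
    omega
  have h1 : k + 1 ≤ Nat.count (fun r => ∀ l < (k + 2) * p, x (s + l) = x (s + r + l))
      (k * p + 1) := by
    rw [Nat.count_eq_card_filter_range]
    conv_lhs => rw [← Finset.card_range (k + 1)]
    refine Finset.card_le_card_of_injOn (· * p) (fun r hr => ?_)
      fun r _ r' _ h => Nat.eq_of_mul_eq_mul_right hp h
    have hr' : r ≤ k := by simpa [Nat.lt_succ_iff] using hr
    simp only [Finset.coe_filter, Finset.mem_range, Set.mem_ofPred_eq, Nat.lt_succ_iff]
    refine ⟨Nat.mul_le_mul_right p hr', fun l hl => ?_⟩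
    clear hr
    induction r with
    | zero => simp
    | succ r ih =>
      have := Nat.mul_le_mul_right p hr'
      rw [add_one_mul] at this ⊢
      rw [ih (by omega), show s + r * p + l = s + (r * p + l) by omega, hper _ (by omega)]
      congr 1
      omega
  rw [h0, Nat.cast_zero, sub_zero, Nat.abs_cast] at h
  have := (Nat.cast_le (α := ℝ)).2 h1
  push_cast at this
  linarith

variable [DecidableEq A] {c : ℕ → A} {X : ℕ → ℕ → A}

lemma exists_run (hX : ∀ n, IsArImage (c n) (X n) (X (n + 1))) {b : A} (t : ℕ) {n : ℕ}
    (h : ∀ j < t, c (n + j) = b) (N : ℕ) : ∃ i ≥ N, ∀ l < t, X n (i + l) = b := by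
  induction t generalizing n N with
  | zero => exact ⟨N, le_rfl, by simp⟩
  | succ t ih =>
    have hb : c n = b := h 0 (by omega)
    obtain ⟨i, hi, hi'⟩ := ih (n := n + 1) (fun j hj => by
      rw [add_assoc, add_comm 1, h _ (by omega)]) (N + 1)
    have hpos (l : ℕ) (hl : l ≤ t) :
        blockPos b (X (n + 1)) (i + l) = blockPos b (X (n + 1)) i + l := by
      induction l with
      | zero => rfl
      | succ l ihl => rw [← add_assoc, blockPos, if_pos (hi' l hl), ihl (by omega), add_assoc]
    have hge : i ≤ blockPos b (X (n + 1)) i := (blockPos_strictMono _ _).le_apply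
    refine ⟨blockPos b (X (n + 1)) i - 1, by omega, fun l hl => ?_⟩
    rw [← hb, ← (hX n).exists_succ_eq_iff, hb]
    exact ⟨i + l, by rw [hpos l (by omega)]; omega⟩

lemma exists_maximal_run [Nontrivial A] (hX : ∀ n, IsArImage (c n) (X n) (X (n + 1)))
    (hdir : ∀ b : A, ∀ N : ℕ, ∃ n, N ≤ n ∧ c n = b) {b : A} {t n : ℕ}
    (h : ∀ j < t, c (n + j) = b) : ∃ i, (∀ l < t, X n (i + l) = b) ∧ X n (i + t) ≠ b := by
  obtain ⟨i, -, hi⟩ := exists_run hX t h 0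
  obtain ⟨b', hb'⟩ := exists_ne b
  have hex : ∃ l, X n (i + l) ≠ b := by
    obtain ⟨k, hk, rfl⟩ := exists_letter_ge hX hdir n b' i
    exact ⟨k - i, by rwa [Nat.add_sub_cancel' hk]⟩
  have hle : t ≤ Nat.find hex := not_lt.1 fun hlt => Nat.find_spec hex (hi _ hlt)
  refine ⟨i + (Nat.find hex - t), fun l hl => ?_, ?_⟩
  · rw [add_assoc]
    exact not_not.1 (Nat.find_min hex (by omega))
  · rw [add_assoc, Nat.sub_add_cancel hle]
    exact Nat.find_spec hex

lemma exists_period [Nontrivial A] (hX : ∀ n, IsArImage (c n) (X n) (X (n + 1)))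
    (hdir : ∀ b : A, ∀ N : ℕ, ∃ n, N ≤ n ∧ c n = b) {b : A} {t n : ℕ}
    (h : ∀ j ≤ t, c (n + j) = b) : ∃ s p, 0 < p ∧
      (∀ l < t * p, X 0 (s + l) = X 0 (s + l + p)) ∧ X 0 (s + t * p) ≠ X 0 (s + t * p + p) := by
  obtain ⟨i, hi, hit⟩ := exists_maximal_run hX hdir (t := t + 1) fun j hj => h j (by omega)
  have hcut (l : ℕ) (hl : l ≤ t + 1) :
      cutPos c X 0 n (i + l) = cutPos c X 0 n i + l * blockLength c 0 n b := by
    induction l with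
    | zero => simp
    | succ l ih =>
      rw [← add_assoc, cutPos_succ hX, ih (by omega), zero_add, hi l hl]
      ring
  refine ⟨cutPos c X 0 n i, blockLength c 0 n b, blockLength_pos _ _ _, fun l hl => ?_, ?_⟩
  · have hp := blockLength_pos (c := c) 0 n b
    have hdiv : l / blockLength c 0 n b < t := Nat.div_lt_of_lt_mul (by rwa [mul_comm])
    have hmod := Nat.mod_lt l hp
    have heq := apply_cutPos_add hX 0 n (i + l / blockLength c 0 n b)
      (i + (l / blockLength c 0 n b + 1))
      (by rw [zero_add, hi _ (by omega), hi _ (by omega)]) (l % blockLength c 0 n b)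
      (by rwa [zero_add, hi _ (by omega)])
    rw [hcut _ (by omega), hcut _ (by omega), add_one_mul] at heq
    have hl' := Nat.div_add_mod' l (blockLength c 0 n b)
    convert heq using 2 <;> omega
  · have h1 := apply_cutPos hX 0 n (i + t)
    have h2 := apply_cutPos hX 0 n (i + (t + 1))
    rw [hcut _ (by omega), zero_add] at h1 h2
    rw [h1, add_assoc, ← add_one_mul, h2, hi t (by omega)]
    exact hit.symm

end Unbalanced

/-- Theorem: a ternary Arnoux–Rauzy word is uniformly factor-balanced if and only if
its directive sequence has bounded weak partial quotients (no `C+1` consecutive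
equal letters, for some `C`). -/
theorem stmt2 {A : Type*} [Fintype A] [DecidableEq A] (hcard : Fintype.card A = 3)
    (c : ℕ → A) (hdir : ∀ b : A, ∀ N : ℕ, ∃ n, N ≤ n ∧ c n = b) (a : A) :
    UniformlyFactorBalanced (arLimit c a) ↔
      ∃ C : ℕ, ∀ n : ℕ, ¬ (∀ j : ℕ, j ≤ C → c (n + j) = c n) := by
  have : Nontrivial A := Fintype.one_lt_card_iff_nontrivial.1 (by omega)
  obtain ⟨a', ha'⟩ := exists_ne a
  have hne (N : ℕ) : ∃ n, N ≤ n ∧ c n ≠ a := by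
    obtain ⟨n, hn, rfl⟩ := hdir a' N
    exact ⟨n, hn, ha'⟩
  have hX (m : ℕ) : IsArImage (c m) (arLimit (fun i => c (m + i)) a)
      (arLimit (fun i => c (m + 1 + i)) a) := by
    have := isArImage_arLimit (c := fun i => c (m + i)) (a := a) fun N => by
      obtain ⟨n, hn, hn'⟩ := hne (m + N)
      exact ⟨n - m, by omega, by rwa [Nat.add_sub_cancel' (by omega)]⟩
    simpa only [add_zero, add_assoc, add_comm 1] using this
  have hx : arLimit c a = arLimit (fun i => c (0 + i)) a := by simp only [zero_add]
  rw [hx]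
  constructor
  · rintro ⟨K, -, hbal⟩
    by_contra! hC
    obtain ⟨n, hn⟩ := hC (2 * ⌈K⌉₊ + 1)
    obtain ⟨s, p, hp, hper, hbreak⟩ :=
      exists_period (X := fun m => arLimit (fun i => c (m + i)) a) hX hdir hn
    obtain ⟨w, hw⟩ := not_balancedIn_of_period hp hper hbreak
      ((Nat.le_ceil K).trans_lt (lt_add_one _))
    exact hw (hbal w)
  · rintro ⟨C, hC⟩
    obtain ⟨K, hK⟩ := exists_forall_countOccs_le (X := fun m => arLimit (fun i => c (m + i)) a)
      hcard hC hX (fun m => arLimit_zero _ a) hdir hne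
    refine ⟨K + 1, by positivity, fun w u v hu hv huv => ?_⟩
    have h1 := (Nat.cast_le (α := ℝ)).2 (hK w u v hu hv huv)
    have h2 := (Nat.cast_le (α := ℝ)).2 (hK w v u hv hu huv.symm)
    push_cast at h1 h2
    rw [abs_le]
    constructor <;> linarith
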